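/- arXiv:1205.5935 — 11 statements merged into one kernel-verified Lean document; each statement's English description precedes it below -/
import Mathlib

section
/- Let K be a field, V a K-vector space, and v : Fin r → V a linearly independent family. For any vector a ∈ V, the product ι(a) * (ι(v 0) * ι(v 1) * ... * ι(v (r-1))) equals 0 in the exterior algebra if and only if a lies in the K-linear span of the range of v. -/
theorem ExteriorAlgebra.ιMulti_ne_zero_of_linearIndependent
    {K V : Type*} [Field K] [AddCommGroup V] [Module K V]
    {n : ℕ} {w : Fin n → V} (hw : LinearIndependent K w) :
    ExteriorAlgebra.ιMulti K n w ≠ 0 := by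
  obtain ⟨g, hg⟩ := (Fintype.linearCombination K w).exists_leftInverse_of_injective
    (LinearMap.ker_eq_bot.mpr hw.fintypeLinearCombination_injective)
  have hgw : Matrix.of (g ∘ w) = 1 := by
    ext i j
    have h := LinearMap.congr_fun hg (Pi.single i 1)
    rw [LinearMap.comp_apply, Fintype.linearCombination_apply_single, one_smul] at h
    rw [Matrix.of_apply, Function.comp_apply, h, LinearMap.id_apply, Matrix.one_apply,
      Pi.single_apply]
    simp only [eq_comm]
  let d : V [⋀^Fin n]→ₗ[K] K := Matrix.detRowAlternating.compLinearMap g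
  have hd : d w = 1 := (congrArg Matrix.det hgw).trans Matrix.det_one
  intro h
  have hlift := exteriorPower.alternatingMapLinearEquiv_apply_ιMulti d w
  rw [show exteriorPower.ιMulti K n w = 0 from Subtype.ext h, map_zero, hd] at hlift
  exact zero_ne_one hlift

theorem ExteriorAlgebra.ιMulti_eq_zero_iff
    {K V : Type*} [Field K] [AddCommGroup V] [Module K V] {n : ℕ} {w : Fin n → V} :
    ExteriorAlgebra.ιMulti K n w = 0 ↔ ¬LinearIndependent K w :=
  ⟨fun h hw ↦ ExteriorAlgebra.ιMulti_ne_zero_of_linearIndependent hw h,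
    (ExteriorAlgebra.ιMulti K n).map_linearDependent w⟩

theorem vec_wedge_blade_eq_zero_iff_mem_span
    (K : Type*) [Field K] (V : Type*) [AddCommGroup V] [Module K V]
    (r : ℕ) (v : Fin r → V) (hv : LinearIndependent K v) (a : V) :
    ExteriorAlgebra.ι K a * (List.ofFn fun i => ExteriorAlgebra.ι K (v i)).prod = 0 ↔
      a ∈ Submodule.span K (Set.range v) := by
  have h : ExteriorAlgebra.ι K a * (List.ofFn fun i => ExteriorAlgebra.ι K (v i)).prod =
      ExteriorAlgebra.ιMulti K (r + 1) (Fin.cons a v) := by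
    simp only [ExteriorAlgebra.ιMulti_apply, List.ofFn_succ, List.prod_cons, Fin.cons_zero,
      Fin.cons_succ]
  rw [h, ExteriorAlgebra.ιMulti_eq_zero_iff, linearIndependent_finCons]
  simp [hv]
end

section
/- Let K be a field, V a K-vector space, and let v, w : Fin r → V both be linearly independent families. Then span K (range v) = span K (range w) if and only if there exists a nonzero scalar c ∈ K such that ι(v 0) * ... * ι(v (r-1)) = c • (ι(w 0) * ... * ι(w (r-1))) in the exterior algebra. -/
namespace ExteriorAlgebra

variable {K V : Type*} [Field K] [AddCommGroup V] [Module K V] {r : ℕ}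

theorem ιMulti_ne_zero_of_linearIndependent_s2 {v : Fin r → V} (hv : LinearIndependent K v) :
    ιMulti K r v ≠ 0 := by
  let e : Fin r ↪o Fin r := RelEmbedding.refl _
  have h := (exteriorPower.ιMulti_family_linearIndependent_field (n := r) hv).ne_zero
    (Set.powersetCard.ofFinEmbEquiv e)
  intro h0
  apply h
  ext
  simpa [exteriorPower.ιMulti_family, e, Function.comp_def] using h0

theorem mem_span_iff_ι_mul_ιMulti_eq_zero {v : Fin r → V} (hv : LinearIndependent K v) (u : V) :
    u ∈ Submodule.span K (Set.range v) ↔ ι K u * ιMulti K r v = 0 := by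
  have hcons : ι K u * ιMulti K r v = ιMulti K (r + 1) (Fin.cons u v) := by
    simp only [ιMulti_apply, List.ofFn_succ, List.prod_cons, Fin.cons_zero, Fin.cons_succ]
  rw [hcons]
  constructor
  · intro hu
    refine AlternatingMap.map_linearDependent _ _ fun h => ?_
    exact (linearIndependent_finCons.mp h).2 hu
  · intro h0
    by_contra hu
    exact ιMulti_ne_zero_of_linearIndependent_s2 (linearIndependent_finCons.mpr ⟨hv, hu⟩) h0

theorem exists_ιMulti_eq_smul_of_mem_span {v w : Fin r → V} (hw : LinearIndependent K w)
    (hvw : ∀ i, v i ∈ Submodule.span K (Set.range w)) :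
    ∃ c : K, ιMulti K r v = c • ιMulti K r w := by
  let b := Module.Basis.span hw
  let f := (ιMulti K r).compLinearMap (Submodule.span K (Set.range w)).subtype
  have hf : f = (LinearMap.toSpanSingleton K _ (ιMulti K r w)).compAlternatingMap b.det := by
    refine Module.Basis.ext_alternating b fun σ hσ => ?_
    let τ : Equiv.Perm (Fin r) := Equiv.ofBijective σ hσ.bijective_of_finite
    have hb : f b = ιMulti K r w := by
      simp [f, b, Module.Basis.span_apply]
    have hτ : (fun i => b (σ i)) = b ∘ τ := rfl
    rw [hτ, AlternatingMap.map_perm, AlternatingMap.map_perm, hb]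
    simp [Module.Basis.det_self]
  refine ⟨b.det fun i => ⟨v i, hvw i⟩, ?_⟩
  simpa [f, Function.comp_def] using DFunLike.congr_fun hf fun i => ⟨v i, hvw i⟩

end ExteriorAlgebra

theorem span_eq_span_iff_blade_smul
    (K : Type*) [Field K] (V : Type*) [AddCommGroup V] [Module K V]
    (r : ℕ) (v w : Fin r → V)
    (hv : LinearIndependent K v) (hw : LinearIndependent K w) :
    Submodule.span K (Set.range v) = Submodule.span K (Set.range w) ↔
      ∃ c : K, c ≠ 0 ∧
        (List.ofFn fun i => ExteriorAlgebra.ι K (v i)).prod =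
          c • (List.ofFn fun i => ExteriorAlgebra.ι K (w i)).prod := by
  simp only [← ExteriorAlgebra.ιMulti_apply]
  constructor
  · intro h
    obtain ⟨c, hc⟩ := ExteriorAlgebra.exists_ιMulti_eq_smul_of_mem_span hw
      fun i => h ▸ Submodule.subset_span (Set.mem_range_self i)
    refine ⟨c, ?_, hc⟩
    rintro rfl
    exact ExteriorAlgebra.ιMulti_ne_zero_of_linearIndependent_s2 hv (by simpa using hc)
  · rintro ⟨c, hc, h⟩
    ext u
    rw [ExteriorAlgebra.mem_span_iff_ι_mul_ιMulti_eq_zero hv,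
      ExteriorAlgebra.mem_span_iff_ι_mul_ιMulti_eq_zero hw, h, mul_smul_comm,
      smul_eq_zero_iff_right hc]
end

section
/- Let K be a field, V a K-vector space, v : Fin r → V and w : Fin s → V linearly independent families with r < s and span K (range v) ≤ span K (range w). Then the smaller blade can be factored out of the larger: there exists a family u : Fin (s - r) → V such that (ι(v 0) * ... * ι(v (r-1))) * (ι(u 0) * ... * ι(u (s-r-1))) = ι(w 0) * ... * ι(w (s-1)) in the exterior algebra. -/
open Module

/-- An alternating map in as many variables as the dimension is determined by its value on a
basis. -/
theorem AlternatingMap.apply_eq_det_smul {R M N ι : Type*} [CommRing R] [AddCommGroup M]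
    [Module R M] [AddCommGroup N] [Module R N] [Fintype ι] [DecidableEq ι]
    (f : M [⋀^ι]→ₗ[R] N) (e : Basis ι R M) (w : ι → M) : f w = e.det w • f e := by
  have h : f = (LinearMap.toSpanSingleton R N (f e)).compAlternatingMap e.det := by
    refine Basis.ext_alternating e fun i hi => ?_
    let σ : Equiv.Perm ι := Equiv.ofBijective i (Finite.injective_iff_bijective.1 hi)
    change f (e ∘ σ) = (LinearMap.toSpanSingleton R N (f e)).compAlternatingMap e.det (e ∘ σ)
    rw [AlternatingMap.map_perm, AlternatingMap.map_perm]
    simp [Basis.det_self]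
  exact DFunLike.congr_fun h w

theorem Module.Basis.sumExtend_inl {K V ι : Type*} [DivisionRing K] [AddCommGroup V]
    [Module K V] {v : ι → V} (hv : LinearIndependent K v) (i : ι) :
    Basis.sumExtend hv (Sum.inl i) = v i := by
  simp only [Basis.sumExtend, Basis.reindex_apply, Basis.extend_apply_self]
  rfl

/-- A linearly independent family in a finite-dimensional space can be completed to a basis by
appending vectors. -/
theorem LinearIndependent.exists_basis_eq_append {K V : Type*} [DivisionRing K]
    [AddCommGroup V] [Module K V] [FiniteDimensional K V] {r t : ℕ} {v : Fin r → V}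
    (hv : LinearIndependent K v) (h : finrank K V = r + t) :
    ∃ (b : Basis (Fin (r + t)) K V) (u : Fin t → V), ⇑b = Fin.append v u := by
  let b := Basis.sumExtend hv
  have : Finite (Fin r ⊕ Basis.sumExtendIndex hv) := Module.Finite.finite_basis b
  have : Finite (Basis.sumExtendIndex hv) := Finite.sum_right (Fin r)
  have hcard : Nat.card (Basis.sumExtendIndex hv) = t := by
    have := finrank_eq_nat_card_basis b
    rw [Nat.card_sum, Nat.card_fin, h] at this
    omega
  let e := Finite.equivFinOfCardEq hcard
  refine ⟨b.reindex (((Equiv.refl _).sumCongr e).trans finSumFinEquiv),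
    fun j => b (Sum.inr (e.symm j)), ?_⟩
  ext i
  refine Fin.addCases (fun i => ?_) (fun j => ?_) i
  · simp [b, Basis.sumExtend_inl]
  · simp

theorem ExteriorAlgebra.exists_ιMulti_mul_ιMulti_eq {K V : Type*} [Field K] [AddCommGroup V]
    [Module K V] {r t : ℕ} (ht : 0 < t) {v : Fin r → V} {w : Fin (r + t) → V}
    (hv : LinearIndependent K v) (hw : LinearIndependent K w)
    (hspan : Submodule.span K (Set.range v) ≤ Submodule.span K (Set.range w)) :
    ∃ u : Fin t → V, ιMulti K r v * ιMulti K t u = ιMulti K (r + t) w := by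
  set W := Submodule.span K (Set.range w)
  let v' : Fin r → W := fun i => ⟨v i, hspan (Submodule.subset_span ⟨i, rfl⟩)⟩
  let w' : Fin (r + t) → W := fun i => ⟨w i, Submodule.subset_span ⟨i, rfl⟩⟩
  have hv' : LinearIndependent K v' := LinearIndependent.of_comp W.subtype hv
  have : FiniteDimensional K W := FiniteDimensional.span_of_finite K (Set.finite_range w)
  obtain ⟨b, u, hb⟩ := hv'.exists_basis_eq_append (t := t) (by
    simpa using finrank_span_eq_card hw)
  have key := congrArg (ExteriorAlgebra.map W.subtype)
    ((ιMulti K (r + t)).apply_eq_det_smul b w')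
  rw [hb, ← ιMulti_mul_ιMulti, map_smul, map_mul] at key
  simp only [map_apply_ιMulti] at key
  let u' : Fin t → V := W.subtype ∘ u
  refine ⟨Function.update u' ⟨0, ht⟩ (b.det w' • u' ⟨0, ht⟩), ?_⟩
  rw [AlternatingMap.map_update_smul, Function.update_eq_self, mul_smul_comm]
  exact key.symm

theorem blade_factor_of_span_le
    (K : Type*) [Field K] (V : Type*) [AddCommGroup V] [Module K V]
    (r s : ℕ) (v : Fin r → V) (w : Fin s → V)
    (hv : LinearIndependent K v) (hw : LinearIndependent K w)
    (hrs : r < s)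
    (hspan : Submodule.span K (Set.range v) ≤ Submodule.span K (Set.range w)) :
    ∃ u : Fin (s - r) → V,
      (List.ofFn fun i => ExteriorAlgebra.ι K (v i)).prod *
          (List.ofFn fun i => ExteriorAlgebra.ι K (u i)).prod =
        (List.ofFn fun i => ExteriorAlgebra.ι K (w i)).prod := by
  obtain ⟨t, rfl⟩ := Nat.exists_eq_add_of_le hrs.le
  rw [Nat.add_sub_cancel_left]
  simpa only [ExteriorAlgebra.ιMulti_apply] using
    ExteriorAlgebra.exists_ιMulti_mul_ιMulti_eq (by omega) hv hw hspan
end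

section
/- Let R be a commutative ring, M an R-module, Q a quadratic form on M, and e : Fin r → M a pairwise orthogonal family (polar Q (e i) (e j) = 0 whenever i ≠ j). Then the fully antisymmetrized product equals r! times the ordered product: Σ_{σ ∈ Perm(Fin r)} sign(σ) • (ι(e (σ 0)) * ι(e (σ 1)) * ... * ι(e (σ (r-1)))) = r! • (ι(e 0) * ι(e 1) * ... * ι(e (r-1))) in the Clifford algebra of Q. -/
/-- Transposing two adjacent anticommuting factors negates an ordered product. -/
theorem List.prod_ofFn_swap_castSucc_succ {A : Type*} [Ring A] {n : ℕ} (k : Fin n)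
    (f : Fin (n + 1) → A)
    (hf : f k.castSucc * f k.succ = -(f k.succ * f k.castSucc)) :
    (List.ofFn fun i => f (Equiv.swap k.castSucc k.succ i)).prod = -(List.ofFn f).prod := by
  induction n with
  | zero => exact k.elim0
  | succ n ih =>
    cases k using Fin.cases with
    | zero =>
      have hne (i : Fin n) : Equiv.swap (0 : Fin (n + 2)) 1 i.succ.succ = i.succ.succ :=
        Equiv.swap_apply_of_ne_of_ne (Fin.succ_ne_zero _) (by simp [Fin.ext_iff])
      simp only [Fin.castSucc_zero, Fin.succ_zero_eq_one] at hf ⊢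
      simp only [List.ofFn_succ, List.prod_cons, Fin.succ_zero_eq_one, Equiv.swap_apply_left,
        Equiv.swap_apply_right, hne, ← mul_assoc, hf, neg_mul, neg_neg]
    | succ k =>
      have h0 : Equiv.swap k.succ.castSucc k.succ.succ 0 = 0 :=
        Equiv.swap_apply_of_ne_of_ne (by simp [Fin.ext_iff]) (Fin.succ_ne_zero _).symm
      have hs (i : Fin (n + 1)) : Equiv.swap k.succ.castSucc k.succ.succ i.succ =
          (Equiv.swap k.castSucc k.succ i).succ := by
        rw [← Fin.succ_castSucc, (Fin.succ_injective _).swap_apply]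
      rw [List.ofFn_succ, List.ofFn_succ (f := f), List.prod_cons, List.prod_cons, h0]
      simp only [hs]
      rw [ih k (fun i => f i.succ) hf, mul_neg]

/-- Permuting the factors of a product of pairwise anticommuting elements multiplies it by the
sign of the permutation. -/
theorem List.prod_ofFn_perm_of_anticommute {A : Type*} [Ring A] {n : ℕ} (σ : Equiv.Perm (Fin n))
    (f : Fin n → A) (hf : ∀ i j, i ≠ j → f i * f j = -(f j * f i)) :
    (List.ofFn fun i => f (σ i)).prod = (Equiv.Perm.sign σ : ℤ) • (List.ofFn f).prod := by
  cases n with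
  | zero => simp [Subsingleton.elim σ 1]
  | succ n =>
    have hσ : σ ∈ Submonoid.closure
        (Set.range fun i : Fin n => Equiv.swap i.castSucc i.succ) := by
      rw [Equiv.Perm.mclosure_swap_castSucc_succ]
      exact Submonoid.mem_top σ
    induction hσ using Submonoid.closure_induction generalizing f with
    | mem τ hτ =>
      obtain ⟨k, rfl⟩ := hτ
      have hk : k.castSucc ≠ k.succ := k.castSucc_lt_succ.ne
      rw [List.prod_ofFn_swap_castSucc_succ k f (hf _ _ hk), Equiv.Perm.sign_swap hk,
        Units.val_neg, Units.val_one, neg_one_smul]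
    | one => simp
    | mul σ τ _ _ ihσ ihτ =>
      simp only [Equiv.Perm.mul_apply]
      rw [ihτ (fun i => f (σ i)) fun i j hij => hf _ _ (σ.injective.ne hij), ihσ f hf,
        smul_smul, Equiv.Perm.sign_mul, Units.val_mul, mul_comm]


theorem antisymmetrized_prod_of_orthogonal
    (R : Type*) [CommRing R] (M : Type*) [AddCommGroup M] [Module R M]
    (Q : QuadraticForm R M) (r : ℕ) (e : Fin r → M)
    (horth : ∀ i j : Fin r, i ≠ j → QuadraticMap.polar Q (e i) (e j) = 0) :
    ∑ σ : Equiv.Perm (Fin r), (Equiv.Perm.sign σ : ℤ) •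
        (List.ofFn fun i => CliffordAlgebra.ι Q (e (σ i))).prod =
      r.factorial • (List.ofFn fun i => CliffordAlgebra.ι Q (e i)).prod := by
  have hanti (i j : Fin r) (hij : i ≠ j) :
      CliffordAlgebra.ι Q (e i) * CliffordAlgebra.ι Q (e j) =
        -(CliffordAlgebra.ι Q (e j) * CliffordAlgebra.ι Q (e i)) := by
    rw [CliffordAlgebra.ι_mul_ι_comm, horth i j hij, map_zero, zero_sub]
  have hterm (σ : Equiv.Perm (Fin r)) : (Equiv.Perm.sign σ : ℤ) •
      (List.ofFn fun i => CliffordAlgebra.ι Q (e (σ i))).prod =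
        (List.ofFn fun i => CliffordAlgebra.ι Q (e i)).prod := by
    rw [List.prod_ofFn_perm_of_anticommute σ (fun i => CliffordAlgebra.ι Q (e i)) hanti,
      smul_smul, ← Units.val_mul, Int.units_mul_self, Units.val_one, one_smul]
  simp only [hterm, Finset.sum_const, Finset.card_univ, Fintype.card_perm, Fintype.card_fin]
end

section
/- Let V be a real vector space, Q a quadratic form on V, and v : Fin r → V an arbitrary family of vectors. Then there exists a pairwise orthogonal family e : Fin r → V (polar Q (e i) (e j) = 0 for i ≠ j) such that Σ_{σ ∈ Perm(Fin r)} sign(σ) • (ι(v (σ 0)) * ... * ι(v (σ (r-1)))) = r! • (ι(e 0) * ... * ι(e (r-1))) in the Clifford algebra of Q; that is, the fully antisymmetrized product of any r vectors equals (r! times) a product of r mutually orthogonal vectors. -/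
theorem List.prod_ofFn_comp_swap_castSucc_succ {A : Type*} [Ring A] {n : ℕ} (i : Fin n)
    (w : Fin (n + 1) → A) (h : w i.succ * w i.castSucc = -(w i.castSucc * w i.succ)) :
    (List.ofFn fun j => w (Equiv.swap i.castSucc i.succ j)).prod = -(List.ofFn w).prod := by
  induction n with
  | zero => exact i.elim0
  | succ n ih =>
    cases i using Fin.cases with
    | zero =>
      have hs : ∀ j : Fin n, Equiv.swap (0 : Fin (n + 2)) 1 j.succ.succ = j.succ.succ := fun j =>
        Equiv.swap_apply_of_ne_of_ne (by simp) (by simp [Fin.ext_iff])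
      simp only [Fin.succ_zero_eq_one, Fin.castSucc_zero] at h ⊢
      simp only [List.ofFn_succ, List.prod_cons, Equiv.swap_apply_left, hs,
        Fin.succ_zero_eq_one, Equiv.swap_apply_right]
      rw [← mul_assoc, h, neg_mul, mul_assoc]
    | succ i =>
      have hs : ∀ j : Fin (n + 1), Equiv.swap i.succ.castSucc i.succ.succ j.succ =
          (Equiv.swap i.castSucc i.succ j).succ := fun j => by
        rw [← Fin.succ_castSucc]
        exact (Fin.succ_injective _).swap_apply _ _ _
      have h0 : Equiv.swap i.succ.castSucc i.succ.succ 0 = 0 :=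
        Equiv.swap_apply_of_ne_of_ne (by simp [Fin.ext_iff]) (by simp [Fin.ext_iff])
      have hw : w i.succ.succ * w i.castSucc.succ = -(w i.castSucc.succ * w i.succ.succ) := by
        rw [Fin.succ_castSucc, h]
      have hprod (u : Fin (n + 2) → A) :
          (List.ofFn u).prod = u 0 * (List.ofFn fun j : Fin (n + 1) => u j.succ).prod := by
        rw [List.ofFn_succ, List.prod_cons]
      rw [hprod, hprod w]
      simp only [hs, h0]
      rw [ih i (fun j => w j.succ) hw, mul_neg]

theorem List.prod_ofFn_comp_perm_of_anticommute {A : Type*} [Ring A] {n : ℕ}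
    (w : Fin n → A) (h : ∀ i j, i ≠ j → w i * w j = -(w j * w i)) (σ : Equiv.Perm (Fin n)) :
    (List.ofFn fun j => w (σ j)).prod = (Equiv.Perm.sign σ : ℤ) • (List.ofFn w).prod := by
  cases n with
  | zero => simp [Subsingleton.elim σ 1]
  | succ n =>
    have hσ : σ ∈ Submonoid.closure
        (Set.range fun i : Fin n => Equiv.swap i.castSucc i.succ) := by
      rw [Equiv.Perm.mclosure_swap_castSucc_succ]; trivial
    induction hσ using Submonoid.closure_induction_right with
    | one => simp
    | mul_right σ _ τ hτ ih =>
      obtain ⟨i, rfl⟩ := hτ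
      have hi : i.castSucc ≠ i.succ := i.castSucc_lt_succ.ne
      have := List.prod_ofFn_comp_swap_castSucc_succ i (fun j => w (σ j))
        (h _ _ fun e => hi (σ.injective e).symm)
      simp only [Equiv.Perm.mul_apply] at this ⊢
      rw [this, ih]
      simp [Equiv.Perm.sign_swap hi]

theorem AlternatingMap.eq_det_smul_basis {R M N ι : Type*} [CommRing R] [AddCommGroup M]
    [Module R M] [AddCommGroup N] [Module R N] [Fintype ι] [DecidableEq ι]
    (f : M [⋀^ι]→ₗ[R] N) (b : Module.Basis ι R M) (v : ι → M) :
    f v = b.det v • f b := by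
  have : f = b.det.smulRight (f b) := by
    refine b.ext_alternating fun g hg => ?_
    let σ : Equiv.Perm ι := Equiv.ofBijective g (Finite.injective_iff_bijective.mp hg)
    have hgσ : (fun i => b (g i)) = b ∘ σ := rfl
    simp [hgσ, AlternatingMap.map_perm, b.det_self]
  conv_lhs => rw [this]
  simp

/-- The antisymmetrized product of vectors in the Clifford algebra, as an alternating map. -/
noncomputable def CliffordAlgebra.antisymmetrizedProd {V : Type*} [AddCommGroup V] [Module ℝ V]
    (Q : QuadraticForm ℝ V) (r : ℕ) : V [⋀^Fin r]→ₗ[ℝ] CliffordAlgebra Q :=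
  MultilinearMap.alternatization
    ((MultilinearMap.mkPiAlgebraFin ℝ r (CliffordAlgebra Q)).compLinearMap
      fun _ => CliffordAlgebra.ι Q)

theorem CliffordAlgebra.antisymmetrizedProd_apply {V : Type*} [AddCommGroup V] [Module ℝ V]
    (Q : QuadraticForm ℝ V) (r : ℕ) (v : Fin r → V) :
    antisymmetrizedProd Q r v = ∑ σ : Equiv.Perm (Fin r), (Equiv.Perm.sign σ : ℤ) •
      (List.ofFn fun i => ι Q (v (σ i))).prod := by
  simp [antisymmetrizedProd, MultilinearMap.alternatization_apply, Units.smul_def]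

theorem CliffordAlgebra.antisymmetrizedProd_apply_of_orthogonal {V : Type*} [AddCommGroup V]
    [Module ℝ V] (Q : QuadraticForm ℝ V) (r : ℕ) (v : Fin r → V)
    (hv : ∀ i j, i ≠ j → QuadraticMap.polar Q (v i) (v j) = 0) :
    antisymmetrizedProd Q r v = r.factorial • (List.ofFn fun i => ι Q (v i)).prod := by
  have h : ∀ i j, i ≠ j → ι Q (v i) * ι Q (v j) = -(ι Q (v j) * ι Q (v i)) := fun i j hij => by
    rw [ι_mul_ι_comm, hv i j hij, map_zero, zero_sub]
  simp only [antisymmetrizedProd_apply,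
    List.prod_ofFn_comp_perm_of_anticommute (fun i => ι Q (v i)) h, smul_smul, ← Units.val_mul,
    Int.units_mul_self, Units.val_one, one_smul, Finset.sum_const, Finset.card_univ,
    Fintype.card_perm, Fintype.card_fin]

theorem QuadraticForm.exists_basis_polar_eq_zero {K W : Type*} [Field K] [Invertible (2 : K)]
    [AddCommGroup W] [Module K W] [FiniteDimensional K W] (Q : QuadraticForm K W) {r : ℕ}
    (hr : Module.finrank K W = r) :
    ∃ b : Module.Basis (Fin r) K W, ∀ i j, i ≠ j → QuadraticMap.polar Q (b i) (b j) = 0 := by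
  subst hr
  obtain ⟨b, hb⟩ := LinearMap.BilinForm.exists_orthogonal_basis
    (B := QuadraticMap.polarBilin Q) ⟨fun x y => QuadraticMap.polar_comm Q x y⟩
  exact ⟨b, fun i j hij => hb hij⟩

theorem antisymmetrized_prod_eq_orthogonal_prod
    (V : Type*) [AddCommGroup V] [Module ℝ V]
    (Q : QuadraticForm ℝ V) (r : ℕ) (v : Fin r → V) :
    ∃ e : Fin r → V,
      (∀ i j : Fin r, i ≠ j → QuadraticMap.polar Q (e i) (e j) = 0) ∧
      ∑ σ : Equiv.Perm (Fin r), (Equiv.Perm.sign σ : ℤ) •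
          (List.ofFn fun i => CliffordAlgebra.ι Q (v (σ i))).prod =
        r.factorial • (List.ofFn fun i => CliffordAlgebra.ι Q (e i)).prod := by
  simp only [← CliffordAlgebra.antisymmetrizedProd_apply]
  suffices ∃ e : Fin r → V, (∀ i j, i ≠ j → QuadraticMap.polar Q (e i) (e j) = 0) ∧
      CliffordAlgebra.antisymmetrizedProd Q r v = CliffordAlgebra.antisymmetrizedProd Q r e by
    obtain ⟨e, he, h⟩ := this
    exact ⟨e, he, h.trans (CliffordAlgebra.antisymmetrizedProd_apply_of_orthogonal Q r e he)⟩
  cases r with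
  | zero => exact ⟨v, fun i => i.elim0, rfl⟩
  | succ n =>
    by_cases hv : LinearIndependent ℝ v
    · have : FiniteDimensional ℝ (Submodule.span ℝ (Set.range v)) :=
        FiniteDimensional.span_of_finite ℝ (Set.finite_range v)
      obtain ⟨b, hb⟩ := QuadraticForm.exists_basis_polar_eq_zero
        (Q.comp (Submodule.span ℝ (Set.range v)).subtype)
        ((finrank_span_eq_card hv).trans (Fintype.card_fin _))
      have hb' : ∀ i j, i ≠ j → QuadraticMap.polar Q (b i : V) (b j) = 0 := fun i j hij => by
        simpa [QuadraticMap.polar] using hb i j hij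
      have h := ((CliffordAlgebra.antisymmetrizedProd Q (n + 1)).compLinearMap
        (Submodule.span ℝ (Set.range v)).subtype).eq_det_smul_basis b
          (fun i => ⟨v i, Submodule.subset_span ⟨i, rfl⟩⟩)
      simp only [AlternatingMap.compLinearMap_apply, Submodule.subtype_apply] at h
      set c := b.det fun i => ⟨v i, Submodule.subset_span ⟨i, rfl⟩⟩
      let u : Fin (n + 1) → V := fun i => b i
      refine ⟨fun i => Function.update (1 : Fin (n + 1) → ℝ) 0 c i • u i, fun i j hij => ?_, ?_⟩
      · rw [QuadraticMap.polar_smul_left, QuadraticMap.polar_smul_right, hb' i j hij]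
        simp
      · refine h.trans ?_
        rw [← AlternatingMap.coe_multilinearMap, MultilinearMap.map_smul_univ]
        simp [Finset.prod_update_of_mem, u]
    · exact ⟨0, by simp [QuadraticMap.polar], by
        rw [AlternatingMap.map_linearDependent _ v hv, AlternatingMap.map_zero]⟩
end

section
/- Let R be a commutative ring, M an R-module, Q a quadratic form on M, e : Fin r → M a pairwise orthogonal family (polar Q (e i) (e j) = 0 for i ≠ j), a ∈ M, and P = ι(e 0) * ... * ι(e (r-1)). Define f : Fin (r+1) → M by f 0 = a and f (i+1) = e i. Then 2 • Σ_{σ ∈ Perm(Fin (r+1))} sign(σ) • (ι(f (σ 0)) * ... * ι(f (σ r))) = (r+1)! • (ι(a) * P + (−1)^r • P * ι(a)) in the Clifford algebra of Q; that is, the average ½(ι(a) * P + (−1)^r P * ι(a)) equals the fully antisymmetrized product of a, e 0, ..., e (r-1). -/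
theorem List.ofFn_comp_swap_take_drop {α : Type*} {n i : ℕ} (v : Fin n → α) (hi : i + 1 < n) :
    (List.ofFn (v ∘ Equiv.swap ⟨i, by lia⟩ ⟨i + 1, hi⟩)).take i = (List.ofFn v).take i ∧
      (List.ofFn (v ∘ Equiv.swap ⟨i, by lia⟩ ⟨i + 1, hi⟩)).drop (i + 2) =
        (List.ofFn v).drop (i + 2) := by
  constructor
  · refine List.ext_getElem (by simp) fun m h₁ h₂ => ?_
    have hm : m < i := by simp at h₁; lia
    simp only [List.getElem_take, List.getElem_ofFn, Function.comp_apply]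
    rw [Equiv.swap_apply_of_ne_of_ne] <;> simp [Fin.ext_iff] <;> lia
  · refine List.ext_getElem (by simp) fun m h₁ h₂ => ?_
    simp only [List.getElem_drop, List.getElem_ofFn, Function.comp_apply]
    rw [Equiv.swap_apply_of_ne_of_ne] <;> simp [Fin.ext_iff] <;> lia

theorem List.ofFn_eq_take_append_cons_cons_drop {α : Type*} {n i : ℕ} (v : Fin n → α)
    (hi : i + 1 < n) :
    List.ofFn v = (List.ofFn v).take i ++
      v ⟨i, by lia⟩ :: v ⟨i + 1, hi⟩ :: (List.ofFn v).drop (i + 2) := by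
  conv_lhs => rw [← List.take_append_drop i (List.ofFn v)]
  rw [List.drop_eq_getElem_cons (by simp; lia), List.drop_eq_getElem_cons (by simp; lia)]
  simp

theorem List.ofFn_insertNth {α : Type*} {n : ℕ} (k : Fin (n + 1)) (a : α) (v : Fin n → α) :
    List.ofFn (k.insertNth a v : Fin (n + 1) → α) =
      (List.ofFn v).take k ++ a :: (List.ofFn v).drop k := by
  induction n with
  | zero =>
    obtain rfl : k = 0 := Subsingleton.elim (α := Fin 1) _ _
    simp
  | succ n ih =>
    cases k using Fin.cases with
    | zero => simp [List.ofFn_succ]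
    | succ k =>
      rw [List.ofFn_succ]
      have h : (fun i : Fin (n + 1) => (k.succ.insertNth a v : Fin (n + 2) → α) i.succ) =
          k.insertNth a fun i => v i.succ := by
        funext i
        cases i using k.succAboveCases with
        | x => simp
        | p j => rw [← Fin.succ_succAbove_succ, Fin.insertNth_apply_succAbove]; simp
      rw [h, ih, List.ofFn_succ (f := v)]
      have h₀ : (k.succ.insertNth a v : Fin (n + 2) → α) 0 = v 0 := by
        rw [← Fin.succ_succAbove_zero k, Fin.insertNth_apply_succAbove]
      simp [h₀]

section Ring

open Equiv

variable {A : Type*} [Ring A]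

/-- Reordering a family of pairwise anticommuting elements changes their product by the sign. -/
theorem sign_smul_prod_ofFn_comp {n : ℕ} (σ : Perm (Fin n)) (g : Fin n → A)
    (hg : ∀ i j, i ≠ j → g i * g j = -(g j * g i)) :
    (Perm.sign σ : ℤ) • (List.ofFn (g ∘ σ)).prod = (List.ofFn g).prod := by
  cases n with
  | zero => simp [Subsingleton.elim σ 1]
  | succ n =>
    have hσ : σ ∈ Submonoid.closure (Set.range fun i : Fin n ↦ swap i.castSucc i.succ) := by
      simp [Perm.mclosure_swap_castSucc_succ]
    induction hσ using Submonoid.closure_induction generalizing g with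
    | one => simp
    | mul σ τ _ _ hσ hτ =>
      rw [Perm.sign_mul, Units.val_mul, mul_smul, Perm.coe_mul, ← Function.comp_assoc,
        hτ (g ∘ σ) fun i j hij => hg _ _ (σ.injective.ne hij), hσ g hg]
    | mem τ hτ =>
      obtain ⟨⟨i, hi⟩, rfl⟩ := hτ
      have h := List.ofFn_comp_swap_take_drop g (i := i) (by lia)
      have hne : (⟨i, by lia⟩ : Fin (n + 1)) ≠ ⟨i + 1, by lia⟩ := by simp [Fin.ext_iff]
      simp only [Fin.castSucc_mk, Fin.succ_mk]
      rw [Perm.sign_swap hne, List.ofFn_eq_take_append_cons_cons_drop (i := i) _ (by lia), h.1, h.2]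
      conv_rhs => rw [List.ofFn_eq_take_append_cons_cons_drop (i := i) g (by lia)]
      simp only [List.prod_append, List.prod_cons, Function.comp_apply, swap_apply_left,
        swap_apply_right]
      rw [← mul_assoc (g _) (g _), ← mul_assoc (g _) (g _), hg _ _ hne]
      simp only [Units.val_neg, Units.val_one, neg_smul, one_smul, neg_mul, mul_neg]

/-- The signed sum over all reorderings of `g` of the products with `a` inserted at position `k`. -/
def signedInsertSum {n : ℕ} (a : A) (g : Fin n → A) (k : ℕ) : A :=
  ∑ τ : Perm (Fin n), (Perm.sign τ : ℤ) •
    (-1 : ℤ) ^ k • (((List.ofFn (g ∘ τ)).take k).prod * (a * ((List.ofFn (g ∘ τ)).drop k).prod))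

theorem signedInsertSum_add_two {n : ℕ} (a : A) (g : Fin n → A)
    (hg : ∀ i z, Commute (a * g i + g i * a) z) {k : ℕ} (hk : k + 2 ≤ n) :
    signedInsertSum a g k - 2 • signedInsertSum a g (k + 1) + signedInsertSum a g (k + 2) = 0 := by
  simp only [signedInsertSum, Finset.smul_sum, ← Finset.sum_sub_distrib, ← Finset.sum_add_distrib]
  have hne : (⟨k, by lia⟩ : Fin n) ≠ ⟨k + 1, by lia⟩ := by simp [Fin.ext_iff]
  have key (v : Fin n → A) :
      (-1 : ℤ) ^ k • (((List.ofFn v).take k).prod * (a * ((List.ofFn v).drop k).prod)) -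
        2 • (-1 : ℤ) ^ (k + 1) •
          (((List.ofFn v).take (k + 1)).prod * (a * ((List.ofFn v).drop (k + 1)).prod)) +
        (-1 : ℤ) ^ (k + 2) •
          (((List.ofFn v).take (k + 2)).prod * (a * ((List.ofFn v).drop (k + 2)).prod)) =
      (-1 : ℤ) ^ k • (((List.ofFn v).take k).prod *
        ((a * v ⟨k, by lia⟩ + v ⟨k, by lia⟩ * a) * v ⟨k + 1, by lia⟩ +
          v ⟨k, by lia⟩ * (a * v ⟨k + 1, by lia⟩ + v ⟨k + 1, by lia⟩ * a)) *
        ((List.ofFn v).drop (k + 2)).prod) := by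
    rw [List.drop_eq_getElem_cons (i := k) (by simp; lia),
      List.drop_eq_getElem_cons (i := k + 1) (by simp; lia),
      List.take_add_one (i := k + 1), List.take_add_one (i := k)]
    rw [List.getElem?_eq_getElem (by simp; lia), List.getElem?_eq_getElem (by simp; lia)]
    simp only [List.getElem_ofFn, List.prod_append, List.prod_cons, Option.toList_some,
      List.prod_nil, mul_one, pow_succ, mul_neg, neg_neg, neg_smul, smul_neg]
    rw [smul_comm 2, sub_neg_eq_add, ← smul_add, ← smul_add]
    congr 1
    noncomm_ring
  refine Finset.sum_involution (fun τ _ => τ * swap (⟨k, by lia⟩ : Fin n) ⟨k + 1, by lia⟩) ?_ ?_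
    (fun _ _ => Finset.mem_univ _) fun τ _ => mul_swap_mul_self _ _ τ
  · intro τ _
    have h := List.ofFn_comp_swap_take_drop (g ∘ τ) (i := k) (by lia)
    have e : g ∘ (τ * swap ⟨k, by lia⟩ ⟨k + 1, by lia⟩ : Perm (Fin n)) =
      (g ∘ τ) ∘ swap ⟨k, by lia⟩ ⟨k + 1, by lia⟩ := rfl
    simp only [smul_comm 2 (_ : ℤ), ← smul_sub, ← smul_add]
    simp only [← smul_comm 2 (_ : ℤ)]
    rw [key, key, e, h.1, h.2, Perm.sign_mul, Perm.sign_swap hne]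
    simp only [Function.comp_apply, swap_apply_left, swap_apply_right, mul_neg, mul_one,
      Units.val_neg, neg_smul]
    rw [(hg _ (g (τ ⟨k, by lia⟩))).eq, (hg _ (g (τ ⟨k + 1, by lia⟩))).eq,
      add_comm (g (τ ⟨k + 1, by lia⟩) * _)]
    exact add_neg_cancel _
  · intro τ _ _ h
    rw [mul_eq_left, swap_eq_one_iff] at h
    exact hne h

theorem two_nsmul_sum_range_of_second_difference_eq_zero {G : Type*} [AddCommGroup G] (T : ℕ → G)
    (n : ℕ) (hT : ∀ k, k + 2 ≤ n → T k - 2 • T (k + 1) + T (k + 2) = 0) :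
    2 • ∑ k ∈ Finset.range (n + 1), T k = (n + 1) • (T 0 + T n) := by
  have lin (k : ℕ) (hk : k + 1 ≤ n) : T (k + 1) = T k + (T 1 - T 0) := by
    induction k with
    | zero => simp
    | succ k ih =>
      have h := hT k hk
      have h' := ih (by lia)
      rw [h'] at h ⊢
      rw [eq_neg_of_add_eq_zero_right h]
      abel
  have lin' (k : ℕ) (hk : k ≤ n) : T k = T 0 + k • (T 1 - T 0) := by
    induction k with
    | zero => simp
    | succ k ih => rw [lin k hk, ih (by lia), succ_nsmul]; abel
  rw [two_nsmul]
  conv_lhs => lhs; rw [← Finset.sum_flip]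
  rw [← Finset.sum_add_distrib, ← Finset.card_range (n + 1), ← Finset.sum_const,
    Finset.card_range]
  refine Finset.sum_congr rfl fun k hk => ?_
  have hkn : k ≤ n := Finset.mem_range_succ_iff.mp hk
  rw [lin' k hkn, lin' (n - k) (Nat.sub_le n k), lin' n le_rfl, add_add_add_comm, ← add_nsmul,
    Nat.sub_add_cancel hkn, add_assoc]

theorem sum_perm_succ_sign_smul_prod {n : ℕ} (f : Fin (n + 1) → A) :
    ∑ σ : Perm (Fin (n + 1)), (Perm.sign σ : ℤ) • (List.ofFn (f ∘ σ)).prod =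
      ∑ k ∈ Finset.range (n + 1), signedInsertSum (f 0) (fun i => f i.succ) k := by
  have hbij : Function.Bijective fun p : Fin (n + 1) × Perm (Fin n) =>
      Perm.decomposeFin.symm (0, p.2) * p.1.cycleRange := by
    rw [Fintype.bijective_iff_injective_and_card]
    refine ⟨?_, by simp [Fintype.card_perm, Nat.factorial_succ]⟩
    rintro ⟨k, τ⟩ ⟨l, ρ⟩ h
    have hkl : k = l := by
      have hk := DFunLike.congr_fun h k
      simp only [Perm.mul_apply, Fin.cycleRange_self, Perm.decomposeFin_symm_apply_zero] at hk
      apply l.cycleRange.injective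
      apply (Perm.decomposeFin.symm (0, ρ)).injective
      rw [← hk, Fin.cycleRange_self, Perm.decomposeFin_symm_apply_zero]
    subst hkl
    simpa using h
  rw [← hbij.sum_comp, Fintype.sum_prod_type, Finset.sum_range]
  refine Finset.sum_congr rfl fun k _ => Finset.sum_congr rfl fun τ _ => ?_
  have e : f ∘ (Perm.decomposeFin.symm (0, τ) * k.cycleRange : Perm (Fin (n + 1))) =
      k.insertNth (f 0) ((fun i => f i.succ) ∘ τ) := by
    funext j
    cases j using k.succAboveCases with
    | x => simp
    | p j => simp
  rw [e, List.ofFn_insertNth, List.prod_append, List.prod_cons]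
  simp [mul_smul]

end Ring

theorem wedge_vec_blade_eq_antisymmetrized
    (R : Type*) [CommRing R] (M : Type*) [AddCommGroup M] [Module R M]
    (Q : QuadraticForm R M) (r : ℕ) (e : Fin r → M)
    (horth : ∀ i j : Fin r, i ≠ j → QuadraticMap.polar Q (e i) (e j) = 0)
    (a : M) (f : Fin (r + 1) → M) (hf0 : f 0 = a)
    (hfs : ∀ i : Fin r, f i.succ = e i) :
    2 • ∑ σ : Equiv.Perm (Fin (r + 1)), (Equiv.Perm.sign σ : ℤ) •
        (List.ofFn fun i => CliffordAlgebra.ι Q (f (σ i))).prod =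
      (r + 1).factorial •
        (CliffordAlgebra.ι Q a * (List.ofFn fun i => CliffordAlgebra.ι Q (e i)).prod +
          (-1 : ℤ) ^ r • ((List.ofFn fun i => CliffordAlgebra.ι Q (e i)).prod *
            CliffordAlgebra.ι Q a)) := by
  have hanti (i j : Fin r) (hij : i ≠ j) : CliffordAlgebra.ι Q (e i) * CliffordAlgebra.ι Q (e j) =
      -(CliffordAlgebra.ι Q (e j) * CliffordAlgebra.ι Q (e i)) := by
    rw [eq_neg_iff_add_eq_zero, CliffordAlgebra.ι_mul_ι_add_swap, horth i j hij, map_zero]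
  have hsign (τ : Equiv.Perm (Fin r)) :=
    sign_smul_prod_ofFn_comp τ (fun i => CliffordAlgebra.ι Q (e i)) hanti
  have hsum := sum_perm_succ_sign_smul_prod (fun i => CliffordAlgebra.ι Q (f i))
  simp only [Function.comp_def, hf0, hfs] at hsum
  have hcomm (i : Fin r) (z : CliffordAlgebra Q) :
      Commute (CliffordAlgebra.ι Q a * CliffordAlgebra.ι Q (e i) +
        CliffordAlgebra.ι Q (e i) * CliffordAlgebra.ι Q a) z := by
    rw [CliffordAlgebra.ι_mul_ι_add_swap]
    exact Algebra.commutes _ _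
  rw [hsum, two_nsmul_sum_range_of_second_difference_eq_zero (signedInsertSum _ _) r fun k hk =>
    signedInsertSum_add_two _ _ hcomm hk, Nat.factorial_succ, mul_smul]
  congr 1
  have h₀ : signedInsertSum (CliffordAlgebra.ι Q a) (fun i => CliffordAlgebra.ι Q (e i)) 0 =
      r.factorial • (CliffordAlgebra.ι Q a *
        (List.ofFn fun i => CliffordAlgebra.ι Q (e i)).prod) := by
    simp [signedInsertSum, ← mul_smul_comm, hsign, Fintype.card_perm]
  have h₁ : signedInsertSum (CliffordAlgebra.ι Q a) (fun i => CliffordAlgebra.ι Q (e i)) r =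
      r.factorial • (-1 : ℤ) ^ r • ((List.ofFn fun i => CliffordAlgebra.ι Q (e i)).prod *
        CliffordAlgebra.ι Q a) := by
    have htake (v : Fin r → CliffordAlgebra Q) : (List.ofFn v).take r = List.ofFn v :=
      List.take_of_length_le (by simp)
    have hdrop (v : Fin r → CliffordAlgebra Q) : (List.ofFn v).drop r = [] :=
      List.drop_of_length_le (by simp)
    simp only [signedInsertSum, htake, hdrop, List.prod_nil, mul_one,
      smul_comm (_ : ℤ) ((-1 : ℤ) ^ r), ← smul_mul_assoc, hsign, Finset.sum_const,
      Finset.card_univ, Fintype.card_perm, Fintype.card_fin]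
  rw [h₀, h₁, smul_add]
end

section
/- Let K be a field, V a K-vector space, Q a quadratic form on V, and l = [a₁, ..., a_r] a list of elements of V, with versor A = ι(a₁) * ... * ι(a_r) in the Clifford algebra of Q. Then A is a unit of the Clifford algebra if and only if Q(a₁) * Q(a₂) * ... * Q(a_r) ≠ 0, in which case (Q(a₁) * ... * Q(a_r))⁻¹ • reverse(A) is a two-sided inverse of A. -/
theorem CliffordAlgebra.nontrivial_of_field
    {K : Type*} [Field K] {V : Type*} [AddCommGroup V] [Module K V]
    (Q : QuadraticForm K V) : Nontrivial (CliffordAlgebra Q) := by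
  obtain ⟨B, hB⟩ := LinearMap.BilinMap.toQuadraticMap_surjective (R := K) (M := V) (N := K)
    (0 - Q)
  have hone := CliffordAlgebra.changeForm_one hB
  have : Nontrivial (CliffordAlgebra (0 : QuadraticForm K V)) :=
    inferInstanceAs (Nontrivial (ExteriorAlgebra K V))
  refine ⟨⟨1, 0, fun h => ?_⟩⟩
  rw [h, map_zero] at hone
  exact zero_ne_one hone

theorem CliffordAlgebra.reverse_mul_prod_map_ι
    {K : Type*} [CommRing K] {V : Type*} [AddCommGroup V] [Module K V]
    (Q : QuadraticForm K V) (l : List V) :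
    CliffordAlgebra.reverse (Q := Q) (l.map fun a => CliffordAlgebra.ι Q a).prod *
        (l.map fun a => CliffordAlgebra.ι Q a).prod =
      algebraMap K _ (l.map fun a => Q a).prod := by
  induction l with
  | nil => simp
  | cons a l ih =>
    simp only [List.map_cons, List.prod_cons, CliffordAlgebra.reverse.map_mul,
      CliffordAlgebra.reverse_ι, map_mul]
    rw [mul_assoc, ← mul_assoc (CliffordAlgebra.ι Q a), CliffordAlgebra.ι_sq_scalar,
      Algebra.left_comm, ih]

theorem CliffordAlgebra.prod_map_ι_mul_reverse
    {K : Type*} [CommRing K] {V : Type*} [AddCommGroup V] [Module K V]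
    (Q : QuadraticForm K V) (l : List V) :
    (l.map fun a => CliffordAlgebra.ι Q a).prod *
        CliffordAlgebra.reverse (Q := Q) (l.map fun a => CliffordAlgebra.ι Q a).prod =
      algebraMap K _ (l.map fun a => Q a).prod := by
  induction l with
  | nil => simp
  | cons a l ih =>
    simp only [List.map_cons, List.prod_cons, CliffordAlgebra.reverse.map_mul,
      CliffordAlgebra.reverse_ι, map_mul]
    rw [mul_assoc, ← mul_assoc (List.prod _), ih, ← mul_assoc, ← Algebra.commutes, mul_assoc,
      CliffordAlgebra.ι_sq_scalar, Algebra.commutes]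

theorem versor_isUnit_iff_nonnull
    (K : Type*) [Field K] (V : Type*) [AddCommGroup V] [Module K V]
    (Q : QuadraticForm K V) (l : List V) :
    (IsUnit ((l.map fun a => CliffordAlgebra.ι Q a).prod) ↔
        (l.map fun a => Q a).prod ≠ 0) ∧
      ((l.map fun a => Q a).prod ≠ 0 →
        ((l.map fun a => Q a).prod⁻¹ •
            CliffordAlgebra.reverse (Q := Q) (l.map fun a => CliffordAlgebra.ι Q a).prod) *
            (l.map fun a => CliffordAlgebra.ι Q a).prod = 1 ∧
          (l.map fun a => CliffordAlgebra.ι Q a).prod *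
            ((l.map fun a => Q a).prod⁻¹ •
              CliffordAlgebra.reverse (Q := Q) (l.map fun a => CliffordAlgebra.ι Q a).prod) = 1) := by
  have inverse : (l.map fun a => Q a).prod ≠ 0 →
      ((l.map fun a => Q a).prod⁻¹ •
          CliffordAlgebra.reverse (Q := Q) (l.map fun a => CliffordAlgebra.ι Q a).prod) *
          (l.map fun a => CliffordAlgebra.ι Q a).prod = 1 ∧
        (l.map fun a => CliffordAlgebra.ι Q a).prod *
          ((l.map fun a => Q a).prod⁻¹ •
            CliffordAlgebra.reverse (Q := Q)
              (l.map fun a => CliffordAlgebra.ι Q a).prod) = 1 := by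
    intro h
    rw [smul_mul_assoc, mul_smul_comm, CliffordAlgebra.reverse_mul_prod_map_ι,
      CliffordAlgebra.prod_map_ι_mul_reverse, Algebra.smul_def, ← map_mul,
      inv_mul_cancel₀ h, map_one]
    exact ⟨rfl, rfl⟩
  refine ⟨⟨fun hu h => ?_, fun h => ?_⟩, inverse⟩
  · have := CliffordAlgebra.nontrivial_of_field Q
    have hzero := CliffordAlgebra.reverse_mul_prod_map_ι Q l
    rw [h, map_zero, hu.mul_left_eq_zero] at hzero
    have hprod := congrArg (CliffordAlgebra.reverse (Q := Q)) hzero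
    rw [CliffordAlgebra.reverse_reverse, map_zero] at hprod
    exact hu.ne_zero hprod
  · exact ⟨⟨_, _, (inverse h).2, (inverse h).1⟩, rfl⟩
end

section
/- Let K be a field, V a K-vector space, Q a quadratic form on V, and let A = ι(a₁) * ... * ι(a_r) and B = ι(b₁) * ... * ι(b_s) be versors built from lists [a₁,...,a_r] and [b₁,...,b_s] of elements of V. If A * B = 0 while A ≠ 0 and B ≠ 0, then both versors are null: Q(a₁) * ... * Q(a_r) = 0 and Q(b₁) * ... * Q(b_s) = 0. -/
theorem CliffordAlgebra.isUnit_prod_map_ι {R M : Type*} [CommRing R] [AddCommGroup M]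
    [Module R M] (Q : QuadraticForm R M) (l : List M) (hl : IsUnit (l.map fun m => Q m).prod) :
    IsUnit (l.map fun m => CliffordAlgebra.ι Q m).prod := by
  induction l with
  | nil => simp
  | cons m l ih =>
    simp only [List.map_cons, List.prod_cons, IsUnit.mul_iff] at hl ⊢
    exact (CliffordAlgebra.isUnit_ι_of_isUnit Q hl.1).mul (ih hl.2)

theorem versor_mul_versor_eq_zero_imp_null
    (K : Type*) [Field K] (V : Type*) [AddCommGroup V] [Module K V]
    (Q : QuadraticForm K V) (la lb : List V)
    (hA : (la.map fun a => CliffordAlgebra.ι Q a).prod ≠ 0)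
    (hB : (lb.map fun a => CliffordAlgebra.ι Q a).prod ≠ 0)
    (h : (la.map fun a => CliffordAlgebra.ι Q a).prod *
        (lb.map fun a => CliffordAlgebra.ι Q a).prod = 0) :
    (la.map fun a => Q a).prod = 0 ∧ (lb.map fun a => Q a).prod = 0 := by
  constructor
  · by_contra hQ
    exact hB ((CliffordAlgebra.isUnit_prod_map_ι Q la (Ne.isUnit hQ)).mul_right_eq_zero.mp h)
  · by_contra hQ
    exact hA ((CliffordAlgebra.isUnit_prod_map_ι Q lb (Ne.isUnit hQ)).mul_left_eq_zero.mp h)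
end

section
/- Let V be a finite-dimensional real vector space of even dimension and Q a quadratic form on V whose polar bilinear form is nondegenerate (if polar Q v w = 0 for all w ∈ V then v = 0). Then an element A of the Clifford algebra of Q commutes with all vectors if and only if it is a scalar: (∀ v ∈ V, ι(v) * A = A * ι(v)) ↔ ∃ r : ℝ, A = algebraMap ℝ (CliffordAlgebra Q) r. -/
namespace CliffordAlgebra

variable {R M : Type*} [CommRing R] [AddCommGroup M] [Module R M] {Q : QuadraticForm R M}

/-- The twisted commutator with a vector is the contraction by its polar form. -/
theorem ι_mul_sub_involute_mul_ι (v : M) (x : CliffordAlgebra Q) :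
    ι Q v * x - involute x * ι Q v = contractLeft (Q.polarBilin v) x := by
  induction x using CliffordAlgebra.left_induction with
  | algebraMap r => simp [Algebra.commutes]
  | add x y hx hy => rw [map_add, map_add, ← hx, ← hy]; noncomm_ring
  | ι_mul x a hx =>
    have h : ι Q v * ι Q a + ι Q a * ι Q v = algebraMap R _ (Q.polarBilin v a) :=
      ι_mul_ι_add_swap v a
    rw [contractLeft_ι_mul, ← hx, map_mul, involute_ι, Algebra.smul_def, ← h]
    noncomm_ring

/-- Multiplying a vector past a product of pairwise anticommuting vectors changes the sign once
for each factor other than the vector itself. -/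
theorem ι_mul_prod_map_ι {κ : Type*} [DecidableEq κ] {e : κ → M}
    (he : ∀ i j, i ≠ j → QuadraticMap.polar Q (e i) (e j) = 0) (j : κ) (l : List κ) :
    ι Q (e j) * (l.map fun i => ι Q (e i)).prod =
      (-1) ^ (l.length + l.count j) * ((l.map fun i => ι Q (e i)).prod * ι Q (e j)) := by
  induction l with
  | nil => simp
  | cons i l ih =>
    rcases eq_or_ne i j with rfl | hij
    · rw [List.map_cons, List.prod_cons, mul_assoc, ih, List.count_cons_self, List.length_cons,
        ← (Commute.neg_one_left (ι Q (e i))).pow_left _ |>.left_comm,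
        add_add_add_comm, pow_add _ _ (1 + 1)]
      simp
    · have h : ι Q (e j) * ι Q (e i) = -(ι Q (e i) * ι Q (e j)) := by
        rw [eq_neg_iff_add_eq_zero, ι_mul_ι_add_swap, he j i hij.symm, map_zero]
      rw [List.map_cons, List.prod_cons, ← mul_assoc, h, List.count_cons_of_ne hij,
        List.length_cons, neg_mul, mul_assoc, ih,
        ← (Commute.neg_one_left (ι Q (e i))).pow_left _ |>.left_comm, mul_assoc,
        add_right_comm, pow_succ]
      simp

theorem involute_prod_map_ι' {κ : Type*} (e : κ → M) (l : List κ) :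
    involute (l.map fun i => ι Q (e i)).prod =
      (-1) ^ l.length * (l.map fun i => ι Q (e i)).prod := by
  have h := involute_prod_map_ι (Q := Q) (l.map e)
  simpa [List.map_map, Function.comp_def, Algebra.smul_def] using h

end CliffordAlgebra

namespace ExteriorAlgebra

variable {R M κ : Type*} [CommRing R] [AddCommGroup M] [Module R M] [Fintype κ]

open CliffordAlgebra in
/-- Euler's identity for homogeneous elements of the exterior algebra. -/
theorem sum_ι_mul_contractLeft_coord (b : Module.Basis κ R M) {n : ℕ} {x : ExteriorAlgebra R M}
    (hx : x ∈ ⋀[R]^n M) :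
    ∑ i, ι R (b i) * contractLeft (b.coord i) x = (n : ExteriorAlgebra R M) * x := by
  induction hx using Submodule.pow_induction_on_left' with
  | algebraMap r =>
    have (i : κ) : contractLeft (b.coord i) (algebraMap R (ExteriorAlgebra R M) r) = 0 :=
      contractLeft_algebraMap _ _ _
    simp [this]
  | add x y i hx hy ihx ihy => simp [mul_add, Finset.sum_add_distrib, ihx, ihy]
  | mem_mul m hm i x hx ih =>
    obtain ⟨a, rfl⟩ := hm
    have hc (i : κ) : contractLeft (b.coord i) (ι R a * x) =
        b.coord i a • x - ι R a * contractLeft (b.coord i) x := contractLeft_ι_mul _ _ _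
    have hs (i : κ) : ι R (b i) * ι R a = -(ι R a * ι R (b i)) :=
      eq_neg_of_add_eq_zero_left (ι_add_mul_swap _ _)
    have ha : ∑ i, b.coord i a • ι R (b i) = ι R a := by
      simp_rw [← map_smul, ← map_sum, Module.Basis.coord_apply, b.sum_repr]
    calc ∑ i, ι R (b i) * contractLeft (b.coord i) (ι R a * x)
        = ∑ i, ((b.coord i a • ι R (b i)) * x +
            ι R a * (ι R (b i) * contractLeft (b.coord i) x)) := by
          refine Finset.sum_congr rfl fun i _ => ?_
          rw [hc, mul_sub, ← mul_assoc, hs, mul_smul_comm, smul_mul_assoc, neg_mul, mul_assoc,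
            sub_neg_eq_add]
      _ = ι R a * x + ι R a * (i * x) := by
          rw [Finset.sum_add_distrib, ← Finset.sum_mul, ha, ← Finset.mul_sum, ih]
      _ = _ := by
          push_cast
          rw [← mul_assoc, ← Nat.cast_comm, add_mul, one_mul, mul_assoc, add_comm]

end ExteriorAlgebra

namespace CliffordAlgebra

section Field

variable {K V : Type*} [Field K] [CharZero K] [AddCommGroup V] [Module K V]
  [FiniteDimensional K V] {Q : QuadraticForm K V}

theorem _root_.ExteriorAlgebra.exists_algebraMap_eq_of_contractLeft_eq_zero
    {x : ExteriorAlgebra K V}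
    (hx : ∀ d : Module.Dual K V, contractLeft d x = 0) :
    ∃ r : K, x = algebraMap K (ExteriorAlgebra K V) r := by
  classical
  let b := Module.finBasis K V
  let N : ExteriorAlgebra K V →ₗ[K] ExteriorAlgebra K V :=
    ∑ i, LinearMap.mulLeft K (ExteriorAlgebra.ι K (b i)) ∘ₗ contractLeft (b.coord i)
  have hN (y : ExteriorAlgebra K V) :
      N y = ∑ i, ExteriorAlgebra.ι K (b i) * contractLeft (b.coord i) y := by
    simp [N]
  have hNx : N x = 0 := by simp [hN, hx]
  let 𝒜 : ℕ → Submodule K (ExteriorAlgebra K V) := fun n => ⋀[K]^n V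
  have hdec := DirectSum.sum_support_decompose 𝒜 x
  have hsum : ∑ n ∈ (DirectSum.decompose 𝒜 x).support,
      (n : K) • (DirectSum.decompose 𝒜 x n : ExteriorAlgebra K V) = 0 := by
    rw [← hNx]
    conv_rhs => rw [← hdec, map_sum]
    refine Finset.sum_congr rfl fun n _ => ?_
    rw [hN, ExteriorAlgebra.sum_ι_mul_contractLeft_coord b (SetLike.coe_mem _), Nat.cast_smul_eq_nsmul,
      nsmul_eq_mul]
  have hzero (n : ℕ) (hn : n ≠ 0) : (DirectSum.decompose 𝒜 x n : ExteriorAlgebra K V) = 0 := by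
    by_cases hmem : n ∈ (DirectSum.decompose 𝒜 x).support
    · have h := congrArg (GradedAlgebra.proj 𝒜 n) hsum
      rw [map_sum, map_zero, Finset.sum_eq_single_of_mem n hmem, map_smul,
        GradedAlgebra.proj_apply, DirectSum.decompose_of_mem_same 𝒜 (SetLike.coe_mem _)] at h
      · exact (smul_eq_zero_iff_right (Nat.cast_ne_zero.mpr hn)).mp h
      · intro m _ hmn
        rw [map_smul, GradedAlgebra.proj_apply,
          DirectSum.decompose_of_mem_ne 𝒜 (SetLike.coe_mem _) hmn, smul_zero]
    · simpa using hmem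
  have hx0 : x ∈ 𝒜 0 := by
    rw [← hdec]
    refine Submodule.sum_mem _ fun n _ => ?_
    rcases eq_or_ne n 0 with rfl | hn
    · exact SetLike.coe_mem _
    · rw [hzero n hn]; exact zero_mem _
  obtain ⟨r, hr⟩ := Submodule.mem_one.mp (by simpa [𝒜] using hx0)
  exact ⟨r, hr.symm⟩

theorem exists_algebraMap_eq_of_contractLeft_eq_zero {x : CliffordAlgebra Q}
    (hx : ∀ d : Module.Dual K V, contractLeft d x = 0) :
    ∃ r : K, x = algebraMap K (CliffordAlgebra Q) r := by
  have : Invertible (2 : K) := invertibleOfNonzero two_ne_zero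
  obtain ⟨r, hr⟩ := ExteriorAlgebra.exists_algebraMap_eq_of_contractLeft_eq_zero
    (x := equivExterior Q x) fun d => by
      have h := changeForm_contractLeft (changeForm.associated_neg_proof (Q := Q)) d x
      rw [hx, map_zero] at h
      exact h.symm
  refine ⟨r, (equivExterior Q).injective (hr.trans ?_)⟩
  exact (changeForm_algebraMap changeForm.associated_neg_proof r).symm

/-- For a nondegenerate form, the twisted centralizer of the vectors consists of scalars. -/
theorem exists_algebraMap_eq_of_ι_mul_eq_involute_mul_ι
    (hQ : ∀ v : V, (∀ w : V, QuadraticMap.polar Q v w = 0) → v = 0) {x : CliffordAlgebra Q}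
    (hx : ∀ v, ι Q v * x = involute x * ι Q v) :
    ∃ r : K, x = algebraMap K (CliffordAlgebra Q) r := by
  refine exists_algebraMap_eq_of_contractLeft_eq_zero fun d => ?_
  have hinj : Function.Injective Q.polarBilin :=
    (injective_iff_map_eq_zero _).mpr fun v hv => hQ v fun w => LinearMap.congr_fun hv w
  obtain ⟨v, rfl⟩ := (LinearMap.injective_iff_surjective_of_finrank_eq_finrank
    Subspace.dual_finrank_eq.symm).mp hinj d
  rw [← ι_mul_sub_involute_mul_ι, hx, sub_self]

/-- In even dimension, the product of an orthogonal basis is an even unit which anticommutes with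
every vector. -/
theorem exists_isUnit_involute_eq_anticommute_ι (hdim : Even (Module.finrank K V))
    (hQ : ∀ v : V, (∀ w : V, QuadraticMap.polar Q v w = 0) → v = 0) :
    ∃ ω : CliffordAlgebra Q, IsUnit ω ∧ involute ω = ω ∧ ∀ v, ι Q v * ω = -(ω * ι Q v) := by
  have : Invertible (2 : K) := invertibleOfNonzero two_ne_zero
  have hsymm : LinearMap.IsSymm Q.polarBilin := ⟨fun v w => QuadraticMap.polar_comm Q v w⟩
  obtain ⟨e, he⟩ := LinearMap.BilinForm.exists_orthogonal_basis hsymm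
  have hortho (i j) (hij : i ≠ j) : QuadraticMap.polar Q (e i) (e j) = 0 := he hij
  have hunit (i) : IsUnit (ι Q (e i)) := by
    refine isUnit_ι_of_isUnit Q (isUnit_iff_ne_zero.mpr fun h => e.ne_zero i (hQ _ fun w => ?_))
    have : Q.polarBilin (e i) = 0 := e.ext fun j => by
      rcases eq_or_ne i j with rfl | hij
      · simp [QuadraticMap.polar_self, h]
      · exact hortho i j hij
    exact LinearMap.congr_fun this w
  let l := List.finRange (Module.finrank K V)
  refine ⟨(l.map fun i => ι Q (e i)).prod, ?_, ?_, fun v => ?_⟩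
  · refine Submonoid.list_prod_mem (IsUnit.submonoid _) fun y hy => ?_
    obtain ⟨i, -, rfl⟩ := List.mem_map.mp hy
    exact hunit i
  · rw [involute_prod_map_ι', List.length_finRange, hdim.neg_one_pow, one_mul]
  · set ω := (l.map fun i => ι Q (e i)).prod with hω
    suffices LinearMap.mulRight K ω ∘ₗ ι Q = -(LinearMap.mulLeft K ω ∘ₗ ι Q) from
      LinearMap.congr_fun this v
    refine e.ext fun j => ?_
    have hcount : l.count j = 1 :=
      List.count_eq_one_of_mem (List.nodup_finRange _) (List.mem_finRange j)
    simpa [hcount, l, hdim.add_one.neg_one_pow] using ι_mul_prod_map_ι hortho j l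

end Field

end CliffordAlgebra

open CliffordAlgebra in
theorem commutes_with_all_vectors_iff_scalar
    (V : Type*) [AddCommGroup V] [Module ℝ V] [FiniteDimensional ℝ V]
    (hdim : Even (Module.finrank ℝ V))
    (Q : QuadraticForm ℝ V)
    (hnd : ∀ v : V, (∀ w : V, QuadraticMap.polar Q v w = 0) → v = 0)
    (A : CliffordAlgebra Q) :
    (∀ v : V, CliffordAlgebra.ι Q v * A = A * CliffordAlgebra.ι Q v) ↔
      ∃ r : ℝ, A = algebraMap ℝ (CliffordAlgebra Q) r := by
  constructor
  · intro hA
    have hinv (v : V) : ι Q v * involute A = involute A * ι Q v := by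
      simpa using congrArg involute (hA v)
    obtain ⟨r, hr⟩ := exists_algebraMap_eq_of_ι_mul_eq_involute_mul_ι hnd (x := A + involute A)
      fun v => by
        rw [map_add, involute_involute, mul_add, add_mul, hA, hinv, add_comm]
    obtain ⟨ω, hω, hωinv, hωι⟩ := exists_isUnit_involute_eq_anticommute_ι hdim hnd
    have hodd : involute (ω * (A - involute A)) = -(ω * (A - involute A)) := by
      rw [map_mul, hωinv, map_sub, involute_involute, ← mul_neg, neg_sub]
    obtain ⟨s, hs⟩ := exists_algebraMap_eq_of_ι_mul_eq_involute_mul_ι hnd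
      (x := ω * (A - involute A)) fun v => by
        rw [hodd, ← mul_assoc, hωι, neg_mul, neg_mul, mul_assoc, mul_assoc, mul_sub (ι Q v), hA,
          hinv, ← sub_mul]
    have hzero : ω * (A - involute A) = 0 := by
      rw [hs, AlgHom.commutes] at hodd
      rw [hs, ← smul_eq_zero_iff_right (two_ne_zero (α := ℝ)), two_smul]
      exact eq_neg_iff_add_eq_zero.mp hodd
    have heven : involute A = A := (sub_eq_zero.mp (hω.mul_right_eq_zero.mp hzero)).symm
    refine ⟨r / 2, ?_⟩
    rw [heven, ← two_smul ℝ A] at hr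
    rw [div_eq_inv_mul, ← smul_eq_mul, Algebra.algebraMap_eq_smul_one, smul_assoc,
      ← Algebra.algebraMap_eq_smul_one, ← hr, smul_smul]
    norm_num
  · rintro ⟨r, rfl⟩ v
    exact (Algebra.commutes r _).symm
end

section
/- Let K be a field and V a K-vector space. If an element x of the exterior algebra of V is idempotent, x * x = x, then x = 0 or x = 1. -/
theorem IsIdempotentElem.eq_zero_of_decompose_zero_eq_zero
    {A σ : Type*} [Ring A] [SetLike σ A] [AddSubmonoidClass σ A]
    (𝒜 : ℕ → σ) [GradedRing 𝒜] {x : A} (hx : IsIdempotentElem x)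
    (h0 : (DirectSum.decompose 𝒜 x 0 : A) = 0) : x = 0 := by
  have key (n : ℕ) : (DirectSum.decompose 𝒜 x n : A) = 0 := by
    induction n using Nat.strong_induction_on with
    | _ n ih =>
      rw [← hx.eq, DirectSum.decompose_mul, DirectSum.coe_mul_apply_eq_sum_antidiagonal]
      refine Finset.sum_eq_zero fun ij hij => ?_
      rw [Finset.HasAntidiagonal.mem_antidiagonal] at hij
      rcases Nat.eq_zero_or_pos ij.2 with hj | hj
      · rw [hj, h0, mul_zero]
      · rw [ih ij.1 (by omega), zero_mul]
  refine (DirectSum.decompose 𝒜).injective (DFinsupp.ext fun n => Subtype.ext ?_)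
  simpa using key n

theorem exterior_idempotent_eq_zero_or_one
    (K : Type*) [Field K] (V : Type*) [AddCommGroup V] [Module K V]
    (x : ExteriorAlgebra K V) (h : x * x = x) :
    x = 0 ∨ x = 1 := by
  have hx : IsIdempotentElem x := h
  let p := GradedRing.projZeroRingHom (fun i : ℕ => ⋀[K]^i V)
  obtain ⟨r, hr⟩ : ∃ r : K, algebraMap K (ExteriorAlgebra K V) r = p x := by
    have hmem : p x ∈ LinearMap.range (ExteriorAlgebra.ι K : V →ₗ[K] _) ^ 0 :=
      SetLike.coe_mem (DirectSum.decompose (fun i : ℕ => ⋀[K]^i V) x 0)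
    rwa [pow_zero, Submodule.mem_one] at hmem
  have hrr : IsIdempotentElem r := by
    apply (ExteriorAlgebra.algebraMap_leftInverse (R := K) V).injective
    rw [map_mul, hr, ← map_mul, h]
  rcases IsIdempotentElem.iff_eq_zero_or_one.mp hrr with rfl | rfl
  · refine Or.inl (hx.eq_zero_of_decompose_zero_eq_zero (fun i : ℕ => ⋀[K]^i V) ?_)
    exact hr.symm.trans (map_zero _)
  · refine Or.inr (sub_eq_zero.mp ?_).symm
    refine hx.one_sub.eq_zero_of_decompose_zero_eq_zero (fun i : ℕ => ⋀[K]^i V) ?_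
    change p (1 - x) = 0
    rw [map_sub, map_one, ← hr, map_one, sub_self]
end

section
/- Let K be a field, V a K-vector space, f : V →ₗ[K] V a linear endomorphism, v : Fin r → V a linearly independent family, and λ ∈ K with λ ≠ 0. If the blade of v is an eigenblade of f with eigenvalue λ, i.e. ExteriorAlgebra.map f (ι(v 0) * ... * ι(v (r-1))) = λ • (ι(v 0) * ... * ι(v (r-1))), then the subspace W = span K (range v) is an invariant subspace on which f is invertible: Submodule.map f W = W. -/
open ExteriorAlgebra in
theorem LinearIndependent.exteriorAlgebra_ιMulti_ne_zero
    {K V : Type*} [Field K] [AddCommGroup V] [Module K V] {n : ℕ} {v : Fin n → V}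
    (hv : LinearIndependent K v) : ιMulti K n v ≠ 0 := by
  have h := (exteriorPower.ιMulti_family_linearIndependent_field (n := n) hv).ne_zero
    (Set.powersetCard.ofFinEmbEquiv (RelEmbedding.refl _))
  contrapose! h
  ext
  simpa [exteriorPower.ιMulti_family, Function.comp_def] using h

open ExteriorAlgebra in
theorem ExteriorAlgebra.ιMulti_ne_zero_iff_linearIndependent
    {K V : Type*} [Field K] [AddCommGroup V] [Module K V] {n : ℕ} {v : Fin n → V} :
    ιMulti K n v ≠ 0 ↔ LinearIndependent K v :=
  ⟨fun h => by_contra fun hv => h ((ιMulti K n).map_linearDependent v hv),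
    LinearIndependent.exteriorAlgebra_ιMulti_ne_zero⟩

open ExteriorAlgebra in
theorem ExteriorAlgebra.ι_mul_ιMulti_eq_zero_iff_mem_span
    {K V : Type*} [Field K] [AddCommGroup V] [Module K V] {n : ℕ} {v : Fin n → V}
    (hv : LinearIndependent K v) (x : V) :
    ι K x * ιMulti K n v = 0 ↔ x ∈ Submodule.span K (Set.range v) := by
  have h : ι K x * ιMulti K n v = ιMulti K (n + 1) (Fin.cons x v) := by
    simp [ιMulti_succ_apply, Matrix.vecTail, Function.comp_def]
  rw [h, ← not_iff_not, ← ne_eq, ιMulti_ne_zero_iff_linearIndependent, linearIndependent_finCons]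
  simp [hv]

theorem eigenblade_invariant_subspace
    (K : Type*) [Field K] (V : Type*) [AddCommGroup V] [Module K V]
    (f : V →ₗ[K] V) (r : ℕ) (v : Fin r → V) (hv : LinearIndependent K v)
    (c : K) (hc : c ≠ 0)
    (h : ExteriorAlgebra.map f (List.ofFn fun i => ExteriorAlgebra.ι K (v i)).prod =
      c • (List.ofFn fun i => ExteriorAlgebra.ι K (v i)).prod) :
    Submodule.map f (Submodule.span K (Set.range v)) = Submodule.span K (Set.range v) := by
  rw [← ExteriorAlgebra.ιMulti_apply, ExteriorAlgebra.map_apply_ιMulti] at h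
  have hfv : LinearIndependent K (f ∘ v) := by
    rw [← ExteriorAlgebra.ιMulti_ne_zero_iff_linearIndependent, h]
    exact smul_ne_zero hc hv.exteriorAlgebra_ιMulti_ne_zero
  have hmap : Submodule.map f (Submodule.span K (Set.range v)) =
      Submodule.span K (Set.range (f ∘ v)) := by
    rw [Submodule.map_span, Set.range_comp]
  rw [hmap]
  have := FiniteDimensional.span_of_finite K (Set.finite_range v)
  refine Submodule.eq_of_le_of_finrank_eq (Submodule.span_le.2 ?_) ?_
  · intro x hx
    have hx' := (ExteriorAlgebra.ι_mul_ιMulti_eq_zero_iff_mem_span hfv x).2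
      (Submodule.subset_span hx)
    rw [h, mul_smul_comm, smul_eq_zero_iff_right hc] at hx'
    exact (ExteriorAlgebra.ι_mul_ιMulti_eq_zero_iff_mem_span hv x).1 hx'
  · rw [finrank_span_eq_card hfv, finrank_span_eq_card hv]
end
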